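/- For every σ ∈ (0,1/4), the function ψ̃_σ is convex on ℝ. -/

import Mathlib

/-- The regularized obstacle function `ψ̃_σ`. -/
noncomputable def psiTilde (σ : ℝ) (r : ℝ) : ℝ :=
  if 0 ≤ r then 0
  else if -σ < r then -r ^ 3 / (6 * σ ^ 2)
  else (1 / (2 * σ)) * (r + σ / 2) ^ 2 + σ / 24

/-- Two differentiable functions whose values and derivatives agree at `a` glue to a
differentiable function. -/
theorem hasDerivAt_ite_le {a : ℝ} {p q p' q' : ℝ → ℝ}
    (hp : ∀ x, HasDerivAt p (p' x) x) (hq : ∀ x, HasDerivAt q (q' x) x)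
    (h : p a = q a) (h' : p' a = q' a) (x : ℝ) :
    HasDerivAt (fun r => if a ≤ r then p r else q r) (if a ≤ x then p' x else q' x) x := by
  rcases lt_trichotomy x a with hx | rfl | hx
  · rw [if_neg hx.not_ge]
    refine (hq x).congr_of_eventuallyEq ?_
    filter_upwards [Iio_mem_nhds hx] with r hr
    exact if_neg (not_le.mpr hr)
  · rw [if_pos le_rfl, ← hasDerivWithinAt_univ, ← Set.Iic_union_Ici (a := x)]
    refine HasDerivWithinAt.union ?_ ?_
    · rw [h']
      refine (hq x).hasDerivWithinAt.congr (fun r hr => ?_) (by simp [h])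
      rcases (Set.mem_Iic.mp hr).eq_or_lt with rfl | hr
      · simp [h]
      · exact if_neg hr.not_ge
    · exact (hp x).hasDerivWithinAt.congr (fun r hr => if_pos hr) (if_pos le_rfl)
  · rw [if_pos hx.le]
    refine (hp x).congr_of_eventuallyEq ?_
    filter_upwards [Ioi_mem_nhds hx] with r hr
    exact if_pos (le_of_lt hr)

/-- The derivative of `psiTilde σ`. -/
theorem hasDerivAt_psiTilde {σ : ℝ} (hσ : 0 < σ) (x : ℝ) :
    HasDerivAt (psiTilde σ)
      (if 0 ≤ x then 0 else if -σ ≤ x then -x ^ 2 / (2 * σ ^ 2) else (x + σ / 2) / σ) x := by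
  have hcubic (r : ℝ) :
      HasDerivAt (fun r : ℝ => -r ^ 3 / (6 * σ ^ 2)) (-r ^ 2 / (2 * σ ^ 2)) r := by
    refine ((hasDerivAt_pow 3 r).fun_neg.div_const (6 * σ ^ 2)).congr_deriv ?_
    field_simp
    norm_num
    ring
  have hquad (r : ℝ) :
      HasDerivAt (fun r : ℝ => (1 / (2 * σ)) * (r + σ / 2) ^ 2 + σ / 24) ((r + σ / 2) / σ) r := by
    refine (((((hasDerivAt_id' r).add_const (σ / 2)).fun_pow 2).const_mul
      (1 / (2 * σ))).add_const (σ / 24)).congr_deriv ?_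
    simp only [Nat.cast_ofNat, Nat.add_one_sub_one, pow_one, mul_one]
    field_simp
  have hneg := hasDerivAt_ite_le (a := -σ) hcubic hquad (by field_simp; norm_num)
    (by field_simp; norm_num)
  have hglue := hasDerivAt_ite_le (a := 0) (fun r => hasDerivAt_const r (0 : ℝ)) hneg
    (by simp [hσ.le]) (by simp [hσ.le]) x
  convert hglue using 1
  funext r
  unfold psiTilde
  rcases eq_or_ne r (-σ) with rfl | hr
  · simp only [lt_irrefl, le_refl, if_true, if_false]
    congr 1
    field_simp
    norm_num
  · simp only [lt_iff_le_and_ne, hr.symm, ne_eq, not_false_eq_true, and_true]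

theorem psiTilde_convex :
    ∀ σ ∈ Set.Ioo (0 : ℝ) (1 / 4), ConvexOn ℝ Set.univ (psiTilde σ) := by
  rintro σ ⟨hσ, -⟩
  refine Monotone.convexOn_univ_of_deriv
    (fun x => (hasDerivAt_psiTilde hσ x).differentiableAt) fun x y hxy => ?_
  rw [(hasDerivAt_psiTilde hσ x).deriv, (hasDerivAt_psiTilde hσ y).deriv]
  have hlin (r : ℝ) : (r + σ / 2) / σ = (2 * σ * r + σ ^ 2) / (2 * σ ^ 2) := by
    field_simp
  have hzero : (0 : ℝ) = 0 / (2 * σ ^ 2) := by simp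
  simp only [hlin]
  split_ifs <;> first
    | linarith
    | (try rw [hzero])
      refine div_le_div_of_nonneg_right ?_ (by positivity)
      nlinarith
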